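/- Let n ≥ 1 and 0 < δ ≤ 1/2. For any finite nonempty set V of [−1,1]-valued trees of depth n and any [δ,1−δ]-valued tree p of depth n, E_y max_{v ∈ V} [ Σ_{t=1}^n η(p_t(y), y_t)·v_t(y) ] ≤ 5·v̄·√(n·log|V| / δ) + 2·v_max·log|V| / δ, where E_y denotes expectation over y ∈ {0,1}^n drawn from the process y_t | y_1,…,y_{t−1} ∼ Bernoulli(p_t(y_1,…,y_{t−1})), v̄ = max_{v ∈ V} max_{y ∈ {0,1}^n} ((1/n) Σ_{t=1}^n v_t(y)²)^{1/2}, and v_max = max_{v ∈ V} max_{y ∈ {0,1}^n} max_{1 ≤ t ≤ n} |v_t(y)|. -/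

import Mathlib

/-- A `Z`-valued tree of depth `n`, encoded as a function of the whole path, is predictable:
`z_t(y)` depends only on `y_1,…,y_{t−1}`. -/
def Predictable {Z : Type*} (n : ℕ) (z : (Fin n → Bool) → Fin n → Z) : Prop :=
  ∀ y y' : Fin n → Bool, ∀ t : Fin n, (∀ s : Fin n, s < t → y s = y' s) → z y t = z y' t

/-- `η(p,a) = −1{a=1}/p + 1{a=0}/(1−p)`. -/
noncomputable def eta (p : ℝ) (a : Bool) : ℝ := if a then -1 / p else 1 / (1 - p)

/-- The probability of the path `y ∈ {0,1}^n` under the process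
`y_t | y_1,…,y_{t−1} ∼ Bernoulli(p_t(y_1,…,y_{t−1}))`. -/
noncomputable def bweight (n : ℕ) (p : (Fin n → Bool) → Fin n → ℝ) (y : Fin n → Bool) : ℝ :=
  ∏ t : Fin n, (if y t then p y t else 1 - p y t)

/-- Fixing the first bit of a predictable tree gives a predictable tree. -/
lemma Predictable.tail {Z : Type*} {n : ℕ} {z : (Fin (n + 1) → Bool) → Fin (n + 1) → Z}
    (hz : Predictable (n + 1) z) (b : Bool) :
    Predictable n fun y t => z (Fin.cons b y) t.succ := by
  intro y y' t h
  refine hz _ _ _ fun s hs => ?_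
  induction s using Fin.cases with
  | zero => simp
  | succ s => simpa using h s (by simpa using hs)

/-- Summing a path weight over all paths, one can sum over the first bit last. -/
lemma Predictable.sum_prod_succ {n : ℕ} {q : (Fin (n + 1) → Bool) → Fin (n + 1) → Bool → ℝ}
    (hq : Predictable (n + 1) q) (y₀ : Fin (n + 1) → Bool) :
    ∑ y, ∏ t, q y t (y t) =
      ∑ b, q y₀ 0 b * ∑ y : Fin n → Bool, ∏ t, q (Fin.cons b y) t.succ (y t) := by
  rw [← (Fin.consEquiv fun _ : Fin (n + 1) => Bool).sum_comp, Fintype.sum_prod_type]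
  refine Finset.sum_congr rfl fun b _ => ?_
  rw [Finset.mul_sum]
  refine Finset.sum_congr rfl fun y _ => ?_
  simp only [Fin.consEquiv_apply, Fin.prod_univ_succ, Fin.cons_zero, Fin.cons_succ]
  change q (Fin.cons b y) 0 b * ∏ t : Fin n, q (Fin.cons b y) t.succ (y t) = _
  rw [hq (Fin.cons b y) y₀ 0 fun s hs => absurd hs (Fin.not_lt_zero s)]

lemma Predictable.sum_prod_le_one {n : ℕ} {q : (Fin n → Bool) → Fin n → Bool → ℝ}
    (hq : Predictable n q) (hq0 : ∀ y t b, 0 ≤ q y t b) (hq1 : ∀ y t, ∑ b, q y t b ≤ 1) :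
    ∑ y, ∏ t, q y t (y t) ≤ 1 := by
  induction n with
  | zero => simp
  | succ n ih =>
    rw [hq.sum_prod_succ fun _ => true]
    exact (Finset.sum_le_sum fun b _ => mul_le_of_le_one_right (hq0 _ _ _)
      (ih (hq.tail b) (fun _ _ _ => hq0 _ _ _) fun _ _ => hq1 _ _)).trans (hq1 _ _)

lemma Predictable.sum_prod_eq_one {n : ℕ} {q : (Fin n → Bool) → Fin n → Bool → ℝ}
    (hq : Predictable n q) (hq1 : ∀ y t, ∑ b, q y t b = 1) :
    ∑ y, ∏ t, q y t (y t) = 1 := by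
  induction n with
  | zero => simp
  | succ n ih =>
    rw [hq.sum_prod_succ fun _ => true, ← hq1 (fun _ => true) 0]
    refine Finset.sum_congr rfl fun b _ => ?_
    rw [ih (hq.tail b) fun _ _ => hq1 _ _, mul_one]

lemma bweight_nonneg {n : ℕ} {p : (Fin n → Bool) → Fin n → ℝ}
    (hp : ∀ y t, p y t ∈ Set.Icc (0 : ℝ) 1) (y : Fin n → Bool) : 0 ≤ bweight n p y := by
  refine Finset.prod_nonneg fun t _ => ?_
  obtain ⟨h0, h1⟩ := hp y t
  split_ifs <;> linarith

lemma sum_bweight {n : ℕ} {p : (Fin n → Bool) → Fin n → ℝ} (hp : Predictable n p) :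
    ∑ y, bweight n p y = 1 := by
  refine Predictable.sum_prod_eq_one (q := fun y t b => if b then p y t else 1 - p y t) ?_ ?_
  · intro y y' t h
    simp only [hp y y' t h]
  · simp

/-- One-step moment generating function bound for the centred variable `η(p, ·)`. -/
lemma bernoulli_exp_eta_le {δ p x : ℝ} (hδ0 : 0 < δ) (hδ : δ ≤ 1 / 2)
    (hp : p ∈ Set.Icc δ (1 - δ)) (hx : |x| ≤ δ) :
    p * Real.exp (eta p true * x) + (1 - p) * Real.exp (eta p false * x) ≤
      Real.exp (2 * x ^ 2 / δ) := by
  obtain ⟨h1, h2⟩ := hp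
  have hp0 : 0 < p := by linarith
  have hp1 : 0 < 1 - p := by linarith
  have key (r : ℝ) (hr : |r| ≤ 1) : Real.exp r ≤ 1 + r + r ^ 2 := by
    have := (abs_le.1 (Real.abs_exp_sub_one_sub_id_le hr)).2
    linarith
  have ht := key (eta p true * x) <| by
    simp only [eta, if_true, abs_mul, abs_div, abs_neg, abs_one, abs_of_pos hp0]
    rw [one_div_mul_eq_div, div_le_one hp0]
    linarith
  have hf := key (eta p false * x) <| by
    simp only [eta, Bool.false_eq_true, if_false, abs_mul, abs_div, abs_one, abs_of_pos hp1]
    rw [one_div_mul_eq_div, div_le_one hp1]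
    linarith
  have hvar : 1 / (p * (1 - p)) ≤ 2 / δ := by
    rw [div_le_div_iff₀ (by positivity) hδ0]
    nlinarith [mul_nonneg (sub_nonneg.2 h1) (sub_nonneg.2 h2)]
  calc
    _ ≤ p * (1 + eta p true * x + (eta p true * x) ^ 2) +
        (1 - p) * (1 + eta p false * x + (eta p false * x) ^ 2) := by gcongr
    _ = 1 + 1 / (p * (1 - p)) * x ^ 2 := by
      simp only [eta, if_true, Bool.false_eq_true, if_false]
      field_simp
      ring
    _ ≤ 1 + 2 / δ * x ^ 2 := by gcongr
    _ = 2 * x ^ 2 / δ + 1 := by ring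
    _ ≤ _ := Real.add_one_le_exp _

/-- Moment generating function bound for the martingale transform of `η` by a tree `v`. -/
lemma sum_bweight_exp_le {n : ℕ} {δ l M : ℝ} (hδ0 : 0 < δ) (hδ : δ ≤ 1 / 2)
    {v p : (Fin n → Bool) → Fin n → ℝ} (hv : Predictable n v) (hp : Predictable n p)
    (hpval : ∀ y t, p y t ∈ Set.Icc δ (1 - δ)) (hl : ∀ y t, |l * v y t| ≤ δ)
    (hM : ∀ y, ∑ t, v y t ^ 2 ≤ M) :
    ∑ y, bweight n p y * Real.exp (l * ∑ t, eta (p y t) (y t) * v y t) ≤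
      Real.exp (2 * l ^ 2 * M / δ) := by
  set q : (Fin n → Bool) → Fin n → Bool → ℝ := fun y t b =>
    (if b then p y t else 1 - p y t) *
      Real.exp (eta (p y t) b * (l * v y t) - 2 * (l * v y t) ^ 2 / δ) with hq_def
  have hq0 : ∀ y t b, 0 ≤ q y t b := by
    intro y t b
    obtain ⟨h0, h1⟩ := hpval y t
    refine mul_nonneg ?_ (Real.exp_pos _).le
    split_ifs <;> linarith
  have hq : Predictable n q := by
    intro y y' t h
    simp only [hq_def, hp y y' t h, hv y y' t h]
  have hq1 : ∀ y t, ∑ b, q y t b ≤ 1 := by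
    intro y t
    have := bernoulli_exp_eta_le hδ0 hδ (hpval y t) (hl y t)
    simp only [hq_def, Fintype.sum_bool, if_true, Bool.false_eq_true, if_false, Real.exp_sub]
    rwa [← mul_div_assoc, ← mul_div_assoc, ← add_div, div_le_one (Real.exp_pos _)]
  have hpath (y : Fin n → Bool) :
      bweight n p y * Real.exp (l * ∑ t, eta (p y t) (y t) * v y t) =
        (∏ t, q y t (y t)) * Real.exp (2 * l ^ 2 * (∑ t, v y t ^ 2) / δ) := by
    simp only [hq_def, Finset.prod_mul_distrib, ← Real.exp_sum, bweight]
    rw [mul_assoc, ← Real.exp_add]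
    congr 2
    rw [Finset.sum_sub_distrib, ← Finset.sum_div, Finset.mul_sum, Finset.mul_sum]
    simp only [mul_pow, ← mul_assoc, mul_left_comm _ l]
    ring
  calc
    _ = ∑ y, (∏ t, q y t (y t)) * Real.exp (2 * l ^ 2 * (∑ t, v y t ^ 2) / δ) :=
      Finset.sum_congr rfl fun y _ => hpath y
    _ ≤ ∑ y, (∏ t, q y t (y t)) * Real.exp (2 * l ^ 2 * M / δ) := by
      gcongr with y _
      · exact Finset.prod_nonneg fun t _ => hq0 _ _ _
      · exact hM y
    _ = (∑ y, ∏ t, q y t (y t)) * Real.exp (2 * l ^ 2 * M / δ) := (Finset.sum_mul ..).symm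
    _ ≤ _ := mul_le_of_le_one_left (Real.exp_pos _).le (hq.sum_prod_le_one hq0 hq1)

/-- Maximal inequality from a uniform exponential moment bound. -/
lemma mul_sum_sup'_le_log_card_add {Ω ι : Type*} [Fintype Ω] {w : Ω → ℝ} (hw : ∀ ω, 0 ≤ w ω)
    (hw1 : ∑ ω, w ω = 1) {V : Finset ι} (hV : V.Nonempty) {S : Ω → ι → ℝ} {l K : ℝ}
    (hK : ∀ v ∈ V, ∑ ω, w ω * Real.exp (l * S ω v) ≤ Real.exp K) :
    l * ∑ ω, w ω * V.sup' hV (S ω) ≤ Real.log V.card + K := by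
  set c := Real.log V.card + K
  have hc : Real.exp c = V.card * Real.exp K := by
    rw [Real.exp_add, Real.exp_log (by exact_mod_cast hV.card_pos)]
  have hpt (ω : Ω) :
      l * V.sup' hV (S ω) ≤ c - 1 + (∑ v ∈ V, Real.exp (l * S ω v)) / Real.exp c := by
    obtain ⟨v, hv, hmax⟩ := V.exists_mem_eq_sup' hV (S ω)
    have h1 := Real.add_one_le_exp (l * S ω v - c)
    rw [Real.exp_sub] at h1
    have h2 := Finset.single_le_sum (f := fun v => Real.exp (l * S ω v))
      (fun _ _ => (Real.exp_pos _).le) hv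
    have h3 := div_le_div_of_nonneg_right h2 (Real.exp_pos c).le
    rw [hmax]
    linarith
  calc
    _ = ∑ ω, w ω * (l * V.sup' hV (S ω)) := by
      rw [Finset.mul_sum]
      exact Finset.sum_congr rfl fun _ _ => mul_left_comm _ _ _
    _ ≤ ∑ ω, w ω * (c - 1 + (∑ v ∈ V, Real.exp (l * S ω v)) / Real.exp c) :=
      Finset.sum_le_sum fun ω _ => mul_le_mul_of_nonneg_left (hpt ω) (hw ω)
    _ = c - 1 + (∑ v ∈ V, ∑ ω, w ω * Real.exp (l * S ω v)) / Real.exp c := by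
      rw [Finset.sum_comm]
      simp only [← Finset.mul_sum, mul_add, Finset.sum_add_distrib, ← Finset.sum_mul, hw1,
        one_mul, ← mul_div_assoc, ← Finset.sum_div]
    _ ≤ c - 1 + (∑ _v ∈ V, Real.exp K) / Real.exp c := by
      gcongr with v hv
      exact hK v hv
    _ = c := by
      rw [Finset.sum_const, nsmul_eq_mul, ← hc, div_self (Real.exp_pos c).ne']
      ring

/-- Optimizing a Bernstein-type bound over the scale `l`. -/
lemma le_bernstein_of_forall_scale {E L a m N δ : ℝ} (hδ : 0 < δ) (hL : 0 ≤ L) (ha : 0 ≤ a)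
    (hm : 0 ≤ m) (hN : 0 ≤ N)
    (h : ∀ l, 0 < l → l * m ≤ δ → l * E ≤ L + 2 * l ^ 2 * (N * a ^ 2) / δ) :
    E ≤ 3 * a * Real.sqrt (N * L / δ) + m * L / δ := by
  have hε : ∀ ε > 0, E ≤ 3 * a * Real.sqrt (N * (L + ε) / δ) + (m + ε) * (L + ε) / δ := by
    intro ε hε
    set B := a * Real.sqrt (N * (L + ε) / δ) with hB
    set C := (m + ε) * (L + ε) / δ with hC
    have hLε : 0 < L + ε := by linarith
    have hB0 : 0 ≤ B := by positivity
    have hC0 : 0 < C := by positivity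
    have hB2 : N * a ^ 2 * (L + ε) / δ = B ^ 2 := by
      rw [hB, mul_pow, Real.sq_sqrt (by positivity)]
      ring
    have hBC : 0 < B + C := by linarith
    have hlE := h ((L + ε) / (B + C)) (by positivity) <| by
      rw [div_mul_eq_mul_div, div_le_iff₀ hBC]
      have : (L + ε) * (m + ε) = δ * C := by rw [hC]; field_simp
      nlinarith [mul_pos hLε hε, mul_nonneg hδ.le hB0]
    have hquad : 2 * ((L + ε) / (B + C)) ^ 2 * (N * a ^ 2) / δ =
        (L + ε) / (B + C) * (2 * B ^ 2 / (B + C)) := by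
      rw [← hB2]
      field_simp
    have hlin : L ≤ (L + ε) / (B + C) * (B + C) := by
      rw [div_mul_cancel₀ _ hBC.ne']
      linarith
    have hE : E ≤ B + C + 2 * B ^ 2 / (B + C) := by
      refine le_of_mul_le_mul_left ?_ (div_pos hLε hBC)
      rw [mul_add]
      linarith
    have : 2 * B ^ 2 / (B + C) ≤ 2 * B := by
      rw [div_le_iff₀ hBC]
      nlinarith
    rw [mul_assoc 3 a]
    linarith
  have hcont : Continuous fun ε : ℝ =>
      3 * a * Real.sqrt (N * (L + ε) / δ) + (m + ε) * (L + ε) / δ := by fun_prop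
  have hlim := (hcont.tendsto 0).mono_left (nhdsWithin_le_nhds (s := Set.Ioi 0))
  simp only [add_zero] at hlim
  exact ge_of_tendsto hlim (eventually_nhdsWithin_of_forall hε)

/-- the Bernstein-type finite-class maximal inequality. For any finite nonempty
set `V` of `[−1,1]`-valued trees of depth `n` and any `[δ,1−δ]`-valued tree `p`,
`E_y max_{v∈V} Σ_t η(p_t(y),y_t)v_t(y) ≤ 5·v̄·√(n log|V|/δ) + 2·v_max·log|V|/δ`, where
`v̄ = max_{v,y} ((1/n)Σ_t v_t(y)²)^{1/2}` and `v_max = max_{v,y,t} |v_t(y)|`. -/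
theorem stmt7 (n : ℕ) (hn : 1 ≤ n) (δ : ℝ) (hδ0 : 0 < δ) (hδ : δ ≤ 1 / 2)
    (V : Finset ((Fin n → Bool) → Fin n → ℝ)) (hV : V.Nonempty)
    (hVtree : ∀ v ∈ V, Predictable n v)
    (hVval : ∀ v ∈ V, ∀ y t, v y t ∈ Set.Icc (-1 : ℝ) 1)
    (p : (Fin n → Bool) → Fin n → ℝ) (hp : Predictable n p)
    (hpval : ∀ y t, p y t ∈ Set.Icc δ (1 - δ)) :
    ∑ y : Fin n → Bool, bweight n p y *
        (V.sup' hV fun v => ∑ t : Fin n, eta (p y t) (y t) * v y t) ≤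
      5 * (V.sup' hV fun v => ⨆ y : Fin n → Bool,
            Real.sqrt ((1 / n) * ∑ t : Fin n, v y t ^ 2)) *
          Real.sqrt (n * Real.log V.card / δ) +
        2 * (V.sup' hV fun v => ⨆ y : Fin n → Bool, ⨆ t : Fin n, |v y t|) *
          Real.log V.card / δ := by
  set a := V.sup' hV fun v => ⨆ y : Fin n → Bool, Real.sqrt ((1 / n) * ∑ t : Fin n, v y t ^ 2)
  set m := V.sup' hV fun v => ⨆ y : Fin n → Bool, ⨆ t : Fin n, |v y t|
  have hn0 : (0 : ℝ) < n := by exact_mod_cast hn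
  have ha : ∀ v ∈ V, ∀ y, Real.sqrt ((1 / n) * ∑ t : Fin n, v y t ^ 2) ≤ a := fun v hv y =>
    (le_ciSup (f := fun y => Real.sqrt ((1 / n) * ∑ t : Fin n, v y t ^ 2))
      (Set.finite_range _).bddAbove y).trans (Finset.le_sup' (fun v : (Fin n → Bool) → Fin n → ℝ =>
        ⨆ y : Fin n → Bool, Real.sqrt ((1 / n) * ∑ t : Fin n, v y t ^ 2)) hv)
  have hm : ∀ v ∈ V, ∀ y t, |v y t| ≤ m := fun v hv y t =>
    ((le_ciSup (f := fun t => |v y t|) (Set.finite_range _).bddAbove t).trans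
      (le_ciSup (f := fun y => ⨆ t : Fin n, |v y t|) (Set.finite_range _).bddAbove y)).trans
      (Finset.le_sup' (fun v : (Fin n → Bool) → Fin n → ℝ =>
        ⨆ y : Fin n → Bool, ⨆ t : Fin n, |v y t|) hv)
  obtain ⟨v₀, hv₀⟩ := hV
  have ha0 : 0 ≤ a := (Real.sqrt_nonneg _).trans (ha v₀ hv₀ fun _ => true)
  have hm0 : 0 ≤ m := (abs_nonneg _).trans (hm v₀ hv₀ (fun _ => true) ⟨0, hn⟩)
  have hL : 0 ≤ Real.log V.card := Real.log_natCast_nonneg _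
  have hsq : ∀ v ∈ V, ∀ y, ∑ t, v y t ^ 2 ≤ n * a ^ 2 := by
    intro v hv y
    have h := (Real.sqrt_le_left ha0).1 (ha v hv y)
    rwa [one_div, inv_mul_le_iff₀ hn0] at h
  refine (le_bernstein_of_forall_scale hδ0 hL ha0 hm0 hn0.le fun l hl hlm => ?_).trans ?_
  · refine mul_sum_sup'_le_log_card_add (bweight_nonneg fun y t => ?_) (sum_bweight hp) _
      fun v hv => sum_bweight_exp_le hδ0 hδ (hVtree v hv) hp hpval (fun y t => ?_) (hsq v hv)
    · exact ⟨hδ0.le.trans (hpval y t).1, (hpval y t).2.trans (by linarith)⟩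
    · rw [abs_mul, abs_of_pos hl]
      exact (mul_le_mul_of_nonneg_left (hm v hv y t) hl.le).trans hlm
  · gcongr
    · norm_num
    · linarith
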